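/- Let T = ⟨𝒜, 𝒲, d⟩ be a tag system with all words ω_i nonempty. For all nonempty words ξ, ζ over 𝒜, if ξ ⟹_T ζ (ζ is produced from ξ by zero or more applications of T), then the formula ▷ → \overrightarrow{ζ} is derivable from P_T together with the formula ▷ → \overrightarrow{ξ}, by modus ponens and substitution. -/

import Mathlib

/-- Propositional formulas over the signature {→}. -/
inductive Fm : Type
  | var : ℕ → Fm
  | imp : Fm → Fm → Fm
  deriving DecidableEq

/-- Apply a substitution (uniform replacement of variables by formulas). -/
def Fm.subst (σ : ℕ → Fm) : Fm → Fm
  | var n => σ n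
  | imp A B => imp (A.subst σ) (B.subst σ)

/-- Derivability from a set of axioms by modus ponens and substitution. -/
inductive Deriv (P : Set Fm) : Fm → Prop
  | ax {A : Fm} : A ∈ P → Deriv P A
  | mp {A B : Fm} : Deriv P A → Deriv P (A.imp B) → Deriv P B
  | subst (σ : ℕ → Fm) {A : Fm} : Deriv P A → Deriv P (A.subst σ)

/-- The fixed variable x⁰. -/
def x0 : Fm := Fm.var 0

/-- Axioms of the intuitionistic implicational calculus Int_{→}:
A1: x → (y → x), A2: (x → (y → z)) → ((x → y) → (x → z)). -/
def IntAx : Set Fm :=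
  { Fm.imp (Fm.var 0) (Fm.imp (Fm.var 1) (Fm.var 0)),
    Fm.imp (Fm.imp (Fm.var 0) (Fm.imp (Fm.var 1) (Fm.var 2)))
      (Fm.imp (Fm.imp (Fm.var 0) (Fm.var 1)) (Fm.imp (Fm.var 0) (Fm.var 2))) }

/-- A ∨ B abbreviates (A → B) → B. -/
def orF (A B : Fm) : Fm := (A.imp B).imp B

/-- E 0 = x⁰ → x⁰ (i.e. E_1), E (k+1) = E k → x⁰. -/
def E : ℕ → Fm
  | 0 => x0.imp x0
  | n + 1 => (E n).imp x0

/-- The code of the letter a_i (letters are elements of `Fin m`). -/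
def code {m : ℕ} (i : Fin m) : Fm := (E i.val).imp (x0.imp (x0.imp x0))

/-- The formula ▷ = ((x⁰ → x⁰) → x⁰) → x⁰. -/
def tri : Fm := ((x0.imp x0).imp x0).imp x0

/-- Right-nested disjunction of a nonempty list of formulas. -/
def rlist : List Fm → Fm
  | [] => x0
  | [A] => A
  | A :: B :: Bs => orF A (rlist (B :: Bs))

def llistAux : Fm → List Fm → Fm
  | A, [] => A
  | A, B :: Bs => llistAux (orF A B) Bs

/-- Left-nested disjunction of a nonempty list of formulas. -/
def llist : List Fm → Fm
  | [] => x0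
  | A :: As => llistAux A As

/-- \overrightarrow{α}: right-nested disjunction of codes of the letters of α. -/
def rword {m : ℕ} (w : List (Fin m)) : Fm := rlist (w.map code)

/-- \overleftarrow{α}: left-nested disjunction of codes of the letters of α. -/
def lword {m : ℕ} (w : List (Fin m)) : Fm := llist (w.map code)

/-- A substitution instance of a member of M. -/
def SubStar (M : Set Fm) : Set Fm := {F | ∃ A ∈ M, ∃ σ : ℕ → Fm, F = Fm.subst σ A}

/-- Two formulas are unifiable if they have a common substitution instance. -/
def Unifiable (A B : Fm) : Prop := ∃ σ τ : ℕ → Fm, Fm.subst σ A = Fm.subst τ B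

/-- The variable v occurs in a formula. -/
def Occurs (v : ℕ) : Fm → Prop
  | Fm.var w => v = w
  | Fm.imp A B => Occurs v A ∨ Occurs v B

/-- Alphabetic formulas (𝒜-formulas) over the alphabet `Fin m`. -/
inductive AForm (m : ℕ) : Fm → Prop
  | ofCode (i : Fin m) : AForm m (code i)
  | ofOr {A B : Fm} : AForm m A → AForm m B → AForm m (orF A B)

/-- A tag system ⟨𝒜, 𝒲, d⟩ with 𝒜 = Fin m. -/
structure TagSystem where
  m : ℕ
  W : Fin m → List (Fin m)
  d : ℕ

/-- One production step of the tag system: a_i β γ ↦ γ ω_i, |β| = d - 1. -/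
def TagStep (T : TagSystem) (ξ ζ : List (Fin T.m)) : Prop :=
  ∃ (i : Fin T.m) (β γ : List (Fin T.m)),
    β.length = T.d - 1 ∧ ξ = i :: (β ++ γ) ∧ ζ = γ ++ T.W i

/-- ⟹_T : reflexive–transitive closure of the one-step production. -/
def TagSteps (T : TagSystem) : List (Fin T.m) → List (Fin T.m) → Prop :=
  Relation.ReflTransGen (TagStep T)

/-- T halts on α: α produces some word shorter than d. -/
def Halts (T : TagSystem) (α : List (Fin T.m)) : Prop :=
  ∃ β, TagSteps T α β ∧ β.length < T.d

/-- Axioms R1: (▷ → (y ∨ \overrightarrow{az}) ∨ u) → (▷ → (\overleftarrow{ya} ∨ z) ∨ u),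
with y = var 1, z = var 2, u = var 3. -/
def R1Ax (m : ℕ) : Set Fm :=
  {F | ∃ a : Fin m, F =
    (tri.imp (orF (orF (Fm.var 1) (orF (code a) (Fm.var 2))) (Fm.var 3))).imp
      (tri.imp (orF (orF (orF (Fm.var 1) (code a)) (Fm.var 2)) (Fm.var 3)))}

/-- Axioms R2: (▷ → \overleftarrow{ya} ∨ z) → (▷ → y ∨ \overrightarrow{az}). -/
def R2Ax (m : ℕ) : Set Fm :=
  {F | ∃ a : Fin m, F =
    (tri.imp (orF (orF (Fm.var 1) (code a)) (Fm.var 2))).imp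
      (tri.imp (orF (Fm.var 1) (orF (code a) (Fm.var 2))))}

/-- Axioms T1: (▷ → \overrightarrow{a_i α y}) → (▷ → \overrightarrow{y ω_i}), |α| = d - 1. -/
def T1Ax (T : TagSystem) : Set Fm :=
  {F | ∃ (i : Fin T.m) (α : List (Fin T.m)), α.length = T.d - 1 ∧
    F = (tri.imp (rlist (((i :: α).map code) ++ [Fm.var 1]))).imp
      (tri.imp (rlist (Fm.var 1 :: (T.W i).map code)))}

/-- Axioms T2: (▷ → \overrightarrow{a_i α}) → (▷ → \overrightarrow{ω_i}), |α| = d - 1. -/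
def T2Ax (T : TagSystem) : Set Fm :=
  {F | ∃ (i : Fin T.m) (α : List (Fin T.m)), α.length = T.d - 1 ∧
    F = (tri.imp (rword (i :: α))).imp (tri.imp (rword (T.W i)))}

/-- P_T = T1 ∪ T2 ∪ R1 ∪ R2. -/
def PT (T : TagSystem) : Set Fm := T1Ax T ∪ T2Ax T ∪ R1Ax T.m ∪ R2Ax T.m

/-- Axioms H: (▷ → \overrightarrow{α}) → A for 0 < |α| < d and A ∈ P₀. -/
def HAx (T : TagSystem) (P₀ : Finset Fm) : Set Fm :=
  {F | ∃ (α : List (Fin T.m)) (A : Fm), 0 < α.length ∧ α.length < T.d ∧ A ∈ P₀ ∧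
    F = (tri.imp (rword α)).imp A}

/-- P_{T,P₀} = P_T ∪ H. -/
def PTP (T : TagSystem) (P₀ : Finset Fm) : Set Fm := PT T ∪ HAx T P₀

/-- The calculus P_{T,ω,P₀} = {W_ω} ∪ P_T ∪ H. -/
def PTot (T : TagSystem) (ω : List (Fin T.m)) (P₀ : Finset Fm) : Set Fm :=
  insert (tri.imp (rword ω)) (PTP T P₀)

/-- Code(α): the four types of codes of a nonempty word α. -/
def CodeSet {m : ℕ} (α : List (Fin m)) : Set Fm :=
  {F | F = tri.imp (rword α)} ∪
  {F | ∃ α₁ α₂ : List (Fin m), α = α₁ ++ α₂ ∧ 2 ≤ α₁.length ∧ 1 ≤ α₂.length ∧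
    F = tri.imp (orF (rword α₁) (rword α₂))} ∪
  {F | ∃ α₁ α₂ α₃ : List (Fin m), α = α₁ ++ α₂ ++ α₃ ∧
    2 ≤ α₁.length ∧ 2 ≤ α₂.length ∧ 1 ≤ α₃.length ∧
    F = tri.imp (orF (orF (lword α₁) (rword α₂)) (rword α₃))} ∪
  {F | ∃ α₁ α₂ : List (Fin m), α = α₁ ++ α₂ ∧ 3 ≤ α₁.length ∧ 1 ≤ α₂.length ∧
    F = tri.imp (orF (lword α₁) (rword α₂))}

/-- Code_T(ω)*: substitution instances of codes of words produced from ω by T. -/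
def CodeTStar (T : TagSystem) (ω : List (Fin T.m)) : Set Fm :=
  {F | ∃ β, TagSteps T ω β ∧ F ∈ SubStar (CodeSet β)}

/-- ⟨P⟩: one application of modus ponens or substitution to members of P. -/
def StepSet (P : Set Fm) : Set Fm :=
  {B | ∃ A, A ∈ P ∧ A.imp B ∈ P} ∪ {B | ∃ A ∈ P, ∃ σ : ℕ → Fm, B = Fm.subst σ A}

/-- ⟨P⟩_n. -/
def Stages (P : Set Fm) : ℕ → Set Fm
  | 0 => P
  | n + 1 => StepSet (Stages P n)

theorem E_subst (σ : ℕ → Fm) (h : σ 0 = x0) (n : ℕ) : (E n).subst σ = E n := by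
  induction n with
  | zero => simp [E, x0, Fm.subst, h]
  | succ n ih => simp only [E, Fm.subst, ih]; simp [x0, Fm.subst, h]

theorem code_subst (σ : ℕ → Fm) (h : σ 0 = x0) {m : ℕ} (i : Fin m) :
    (code i).subst σ = code i := by
  simp only [code, Fm.subst, E_subst σ h]; simp [x0, Fm.subst, h]

theorem tri_subst (σ : ℕ → Fm) (h : σ 0 = x0) : tri.subst σ = tri := by
  simp [tri, x0, Fm.subst, h]

theorem orF_subst (σ : ℕ → Fm) (A B : Fm) :
    (orF A B).subst σ = orF (A.subst σ) (B.subst σ) := rfl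

theorem rlist_cons (A : Fm) (l : List Fm) (hl : l ≠ []) :
    rlist (A :: l) = orF A (rlist l) := by
  cases l with
  | nil => exact absurd rfl hl
  | cons B Bs => rfl

theorem rlist_subst (σ : ℕ → Fm) (h : σ 0 = x0) (l : List Fm) :
    (rlist l).subst σ = rlist (l.map (Fm.subst σ)) := by
  induction l with
  | nil => simp [rlist, x0, Fm.subst, h]
  | cons A l ih =>
    by_cases hl : l = []
    · subst hl; rfl
    · rw [rlist_cons A l hl, orF_subst, ih, List.map_cons, rlist_cons]
      simpa using hl

theorem map_code_subst (σ : ℕ → Fm) (h : σ 0 = x0) {m : ℕ} (l : List (Fin m)) :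
    (l.map code).map (Fm.subst σ) = l.map code := by
  simp [code_subst σ h]

theorem rlist_append (l l' : List Fm) (hl' : l' ≠ []) :
    rlist (l ++ [rlist l']) = rlist (l ++ l') := by
  induction l with
  | nil => rfl
  | cons A l ih =>
    rw [List.cons_append, List.cons_append, rlist_cons _ _ (by simp),
      rlist_cons _ _ (by simp [hl']), ih]

/-- The substitution y, z, u := A, B, C. -/
def sub3 (A B C : Fm) : ℕ → Fm
  | 1 => A
  | 2 => B
  | 3 => C
  | n => Fm.var n

theorem sub3_zero (A B C : Fm) : sub3 A B C 0 = x0 := rfl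

theorem use_R1 {T : TagSystem} {P : Set Fm} (hP : PT T ⊆ P) (a : Fin T.m) (y z u : Fm)
    (h : Deriv P (tri.imp (orF (orF y (orF (code a) z)) u))) :
    Deriv P (tri.imp (orF (orF (orF y (code a)) z) u)) := by
  have h1 : Deriv P _ := Deriv.subst (sub3 y z u)
    (Deriv.ax (hP (Or.inl (Or.inr ⟨a, rfl⟩))))
  simp only [Fm.subst, orF_subst, tri_subst _ (sub3_zero y z u),
    code_subst _ (sub3_zero y z u)] at h1
  exact Deriv.mp h h1

theorem use_R2 {T : TagSystem} {P : Set Fm} (hP : PT T ⊆ P) (a : Fin T.m) (y z : Fm)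
    (h : Deriv P (tri.imp (orF (orF y (code a)) z))) :
    Deriv P (tri.imp (orF y (orF (code a) z))) := by
  have h1 : Deriv P _ := Deriv.subst (sub3 y z z)
    (Deriv.ax (hP (Or.inr ⟨a, rfl⟩)))
  simp only [Fm.subst, orF_subst, tri_subst _ (sub3_zero y z z),
    code_subst _ (sub3_zero y z z)] at h1
  exact Deriv.mp h h1

theorem reassoc {T : TagSystem} {P : Set Fm} (hP : PT T ⊆ P) (u : List (Fin T.m))
    (hu : u ≠ []) (w : List (Fin T.m)) : ∀ (a : Fin T.m) (L : Fm),
    Deriv P (tri.imp (orF (orF L (rword (a :: w))) (rword u))) →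
    Deriv P (tri.imp (orF L (rword (a :: w ++ u)))) := by
  induction w with
  | nil =>
    intro a L h
    have h2 := use_R2 hP a L (rword u) h
    have e : rword ([a] ++ u) = orF (code a) (rword u) :=
      rlist_cons _ _ (by simpa using hu)
    rw [e]; exact h2
  | cons b w ih =>
    intro a L h
    exact use_R2 hP a L _ (ih b _ (use_R1 hP a L _ _ h))

theorem step_deriv {T : TagSystem} {P : Set Fm} (hP : PT T ⊆ P) (hW : ∀ i, T.W i ≠ [])
    (ξ ζ : List (Fin T.m)) (hs : TagStep T ξ ζ)
    (h : Deriv P (tri.imp (rword ξ))) : Deriv P (tri.imp (rword ζ)) := by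
  obtain ⟨i, β, γ, hβ, rfl, rfl⟩ := hs
  have hWi : (T.W i).map (code (m := T.m)) ≠ [] := by simpa using hW i
  cases γ with
  | nil =>
    rw [List.append_nil] at h
    exact Deriv.mp h (Deriv.ax (hP (Or.inl (Or.inl (Or.inr ⟨i, β, hβ, rfl⟩)))))
  | cons g γ =>
    have h1 : Deriv P _ := Deriv.subst (sub3 (rword (g :: γ)) x0 x0)
      (Deriv.ax (hP (Or.inl (Or.inl (Or.inl ⟨i, β, hβ, rfl⟩)))))
    have z := sub3_zero (rword (g :: γ)) x0 x0
    simp only [Fm.subst, tri_subst _ z, rlist_subst _ z, List.map_append,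
      map_code_subst _ z, List.map_cons (f := Fm.subst _), List.map_nil] at h1
    have e : sub3 (rword (g :: γ)) x0 x0 1 = rword (g :: γ) := rfl
    rw [e, rlist_cons _ _ hWi] at h1
    have e2 : rlist ((i :: β).map code ++ [rword (g :: γ)]) = rword (i :: (β ++ g :: γ)) := by
      unfold rword
      rw [rlist_append _ _ (by simp)]
      simp
    rw [e2] at h1
    have h2 := Deriv.mp h h1
    cases γ with
    | nil =>
      have e3 : rword ([g] ++ T.W i) = orF (code g) (rword (T.W i)) := rlist_cons _ _ hWi
      rw [e3]; exact h2
    | cons b γ => exact reassoc hP (T.W i) (hW i) γ b (code g) h2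

/-- If ξ ⟹_T ζ then P_T, ▷ → \overrightarrow{ξ} ⊢ ▷ → \overrightarrow{ζ}. -/
theorem stmt_12 (T : TagSystem) (hW : ∀ i, T.W i ≠ []) (hd : 1 ≤ T.d)
    (ξ ζ : List (Fin T.m)) (hξ : ξ ≠ []) (hζ : ζ ≠ []) (h : TagSteps T ξ ζ) :
    Deriv (PT T ∪ {tri.imp (rword ξ)}) (tri.imp (rword ζ)) := by
  induction h with
  | refl => exact Deriv.ax (Or.inr rfl)
  | @tail b c hab hbc ih =>
    have hb : b ≠ [] := by
      obtain ⟨i, β, γ, -, rfl, -⟩ := hbc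
      simp
    exact step_deriv Set.subset_union_left hW _ _ hbc (ih hb)
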